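/- For γ ∈ {12★, 1★3}: two permutations π and σ are equivalent under the bidirectional replacement 123 ↔ γ if and only if p_γ(π) = p_γ(σ). -/

import Mathlib

/-!
Pattern-replacement equivalences between permutations of different lengths
(arXiv:1309.4802). A ★-pattern is encoded as a `List (Option ℕ)`, where `none`
is the placeholder ★ and `some k` an integer entry.
-/

/-- A ★-pattern / star-string entry: `none` is ★, `some k` an integer `k`. -/
abbrev SPat := List (Option ℕ)

/-- The integer entries of a star-string, in order. -/
def ints (ρ : SPat) : List ℕ := ρ.filterMap id

/-- Two lists of naturals are order-isomorphic. -/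
def OrdIso (u v : List ℕ) : Prop :=
  u.length = v.length ∧
  ∀ i j, i < u.length → j < u.length → (u.getD i 0 < u.getD j 0 ↔ v.getD i 0 < v.getD j 0)

/-- A valid string of distinct positive integers and ★'s. -/
def StarStr (ρ : SPat) : Prop := (ints ρ).Nodup ∧ ∀ k ∈ ints ρ, 0 < k

/-- `r` (entry by entry) forms a copy of the ★-pattern `δ`: ★'s in the same
positions, and the integer entries order-isomorphic. -/
def IsCopy (r δ : SPat) : Prop :=
  r.length = δ.length ∧
  (∀ i, (r.getD i none = none ↔ δ.getD i none = none)) ∧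
  OrdIso (ints r) (ints δ)

/-- `Repl a b ρ₁ ρ₂` : `ρ₂` is obtained from `ρ₁` by replacing an occurrence of `a`
as a (not necessarily contiguous) substring of `ρ₁` by `b`, entry by entry at the
same positions. -/
inductive Repl : SPat → SPat → SPat → SPat → Prop
  | nil : Repl [] [] [] []
  | keep {a b ρ₁ ρ₂} (x : Option ℕ) : Repl a b ρ₁ ρ₂ → Repl a b (x :: ρ₁) (x :: ρ₂)
  | repl {a b ρ₁ ρ₂} (x y : Option ℕ) :
      Repl a b ρ₁ ρ₂ → Repl (x :: a) (y :: b) (x :: ρ₁) (y :: ρ₂)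

/-- `π` is a permutation of `1, …, n` (as a list). -/
def IsPermList (π : List ℕ) : Prop := π.Perm (List.range' 1 π.length)

/-- `σ` is a result of the replacement `α → β` applied to the permutation `π`:
(1) `ρ₁` is `π` renumbered (order-isomorphically) with ★'s inserted anywhere;
(2) a substring `a` of `ρ₁` forming a copy of `α` is replaced (in place) by a
string `b` that is a copy of `β`, whose integers meet `ρ₁` only inside `a`, and
which agrees with `a` on the integer entries common to `α` and `β`;
(3) dropping ★'s and renumbering gives the permutation `σ`. -/
def IsResult (α β : SPat) (π σ : List ℕ) : Prop :=
  ∃ ρ₁ ρ₂ a b : SPat,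
    StarStr ρ₁ ∧ OrdIso π (ints ρ₁) ∧
    IsCopy a α ∧
    StarStr b ∧ IsCopy b β ∧
    (∀ k ∈ ints b, k ∈ ints ρ₁ → k ∈ ints a) ∧
    (∀ i j x, α.getD i none = some x → β.getD j none = some x →
      a.getD i none = b.getD j none) ∧
    Repl a b ρ₁ ρ₂ ∧
    IsPermList σ ∧ OrdIso (ints ρ₂) σ

/-- Equivalence under the bidirectional replacement `α ↔ β`: a finite sequence
of `α → β` and `β → α` replacements. -/
def PermEquiv (α β : SPat) (π σ : List ℕ) : Prop :=
  Relation.ReflTransGen (fun τ υ => IsResult α β τ υ ∨ IsResult β α τ υ) π σ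

/-- `π` is isolated under `α ↔ β`: no other permutation is equivalent to it. -/
def Isolated (α β : SPat) (π : List ℕ) : Prop :=
  ∀ σ : List ℕ, IsPermList σ → PermEquiv α β π σ → σ = π

/-- The identity permutation `1 2 ⋯ n`. -/
def idPerm (n : ℕ) : List ℕ := List.range' 1 n

/-- The reverse identity permutation `n (n-1) ⋯ 1`. -/
def ridPerm (n : ℕ) : List ℕ := (List.range' 1 n).reverse

def pat123 : SPat := [some 1, some 2, some 3]
def pat132 : SPat := [some 1, some 3, some 2]
def patS32 : SPat := [none, some 3, some 2]
def pat3S2 : SPat := [some 3, none, some 2]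
def pat32S : SPat := [some 3, some 2, none]
def patS31 : SPat := [none, some 3, some 1]
def pat3S1 : SPat := [some 3, none, some 1]
def pat31S : SPat := [some 3, some 1, none]
def patS21 : SPat := [none, some 2, some 1]
def pat2S1 : SPat := [some 2, none, some 1]
def pat21S : SPat := [some 2, some 1, none]
def pat12S : SPat := [some 1, some 2, none]
def pat1S3 : SPat := [some 1, none, some 3]
def patS23 : SPat := [none, some 2, some 3]
def patS12 : SPat := [none, some 1, some 2]
def pat23S : SPat := [some 2, some 3, none]
def pat13S : SPat := [some 1, some 3, none]
def pat1S2 : SPat := [some 1, none, some 2]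

/-- `l` contains a (not necessarily contiguous) copy of the pattern `123`. -/
def contains123 (l : List ℕ) : Prop :=
  ∃ i j k, i < j ∧ j < k ∧ k < l.length ∧
    l.getD i 0 < l.getD j 0 ∧ l.getD j 0 < l.getD k 0

/-- All copies of `123` in `l` (as triples of 0-indexed positions), listed in
lexicographic order: first by position of the smallest element, then of the
middle element, then of the largest element. -/
def triples123 (l : List ℕ) : List (ℕ × ℕ × ℕ) :=
  (List.range l.length).flatMap fun i =>
    (List.range l.length).flatMap fun j =>
      (List.range l.length).filterMap fun k =>
        if i < j ∧ j < k ∧ l.getD i 0 < l.getD j 0 ∧ l.getD j 0 < l.getD k 0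
        then some (i, j, k) else none

/-- The leftmost copy of `123` in `l`, if any. -/
def leftmost123 (l : List ℕ) : Option (ℕ × ℕ × ℕ) := (triples123 l).head?

/-- Repeatedly (with fuel) erase, from the leftmost copy of `123`, the entry at
the position selected by `d`, until no copy of `123` remains. -/
def pIter (d : ℕ × ℕ × ℕ → ℕ) : ℕ → List ℕ → List ℕ
  | 0, l => l
  | n + 1, l =>
    match leftmost123 l with
    | none => l
    | some t => pIter d n (l.eraseIdx (d t))

/-- Renumber a list of distinct naturals, preserving relative order, into a
permutation of `1, …, n`. -/
def renumber (l : List ℕ) : List ℕ := l.map fun x => (l.filter fun y => y ≤ x).length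

def pGamma (d : ℕ × ℕ × ℕ → ℕ) (l : List ℕ) : List ℕ := renumber (pIter d l.length l)

/-- `p_γ` for `γ = 12★`: repeatedly delete the largest element of the leftmost
copy of `123`, then renumber. -/
def p12star (l : List ℕ) : List ℕ := pGamma (fun t => t.2.2) l

/-- `p_γ` for `γ = 1★3`: repeatedly delete the middle element of the leftmost
copy of `123`, then renumber. -/
def p1star3 (l : List ℕ) : List ℕ := pGamma (fun t => t.2.1) l

/-- The selected entry of a triple: the largest for `true`, the middle for `false`. -/
def selE (c : Bool) (y z : ℕ) : ℕ := if c then z else y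

/-- `w` is the deletable entry of some copy of `123` in `l`. -/
def BadE (c : Bool) (l : List ℕ) (w : ℕ) : Prop :=
  ∃ x y z, [x, y, z].Sublist l ∧ x < y ∧ y < z ∧ w = selE c y z

open Classical in
/-- The normal form: drop all deletable entries. -/
noncomputable def nfE (c : Bool) (l : List ℕ) : List ℕ := l.filter fun w => ¬ BadE c l w

lemma glueE {l : List ℕ} (hl : l.Nodup) {a : ℕ} {v : List ℕ} :
    ∀ {u : List ℕ}, (u ++ [a]).Sublist l → (a :: v).Sublist l → (u ++ a :: v).Sublist l := by
  induction l with
  | nil => intro u h; simp at h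
  | cons b l ih =>
    intro u h1 h2
    rw [List.nodup_cons] at hl
    have key : a ∈ l → (a :: v).Sublist l := by
      intro ha
      cases h2 with
      | cons _ h => exact h
      | cons_cons _ h => exact absurd ha hl.1
    cases u with
    | nil => simpa using h2
    | cons d u =>
      rw [List.cons_append] at h1 ⊢
      cases h1 with
      | cons _ h =>
        have ha : a ∈ l := h.subset (by simp)
        exact (ih hl.2 (u := d :: u) h (key ha)).cons _
      | cons_cons _ h =>
        have ha : a ∈ l := h.subset (by simp)
        exact (ih hl.2 h (key ha)).cons_cons _

lemma sub_eraseE {l t : List ℕ} {w : ℕ} (h : t.Sublist l) (hw : w ∉ t) : t.Sublist (l.erase w) := by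
  have := h.erase w
  rwa [List.erase_of_not_mem hw] at this

lemma bad_eraseE (c : Bool) {l : List ℕ} (hl : l.Nodup) {w v : ℕ} (hw : BadE c l w) (hv : v ≠ w) :
    BadE c (l.erase w) v ↔ BadE c l v := by
  constructor
  · rintro ⟨x, y, z, h, h'⟩
    exact ⟨x, y, z, h.trans List.erase_sublist, h'⟩
  · rintro ⟨x, y, z, h, hxy, hyz, rfl⟩
    obtain ⟨x1, y1, z1, h1, hxy1, hyz1, rfl⟩ := hw
    cases c
    · simp only [selE, Bool.false_eq_true, if_false] at hv ⊢
      by_cases hx : x = y1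
      · subst hx
        have g := glueE hl (u := [x1]) (a := x) (v := [y, z])
          ((by simp : ([x1] ++ [x]).Sublist [x1, x, z1]).trans h1) h
        refine ⟨x1, y, z, sub_eraseE ((by simp : [x1, y, z].Sublist ([x1] ++ [x, y, z])).trans g) ?_,
          by omega, hyz, rfl⟩
        simp; omega
      · by_cases hz : z = y1
        · subst hz
          have g := glueE hl (u := [x, y]) (a := z) (v := [z1]) h
            ((by simp : ([z, z1]).Sublist [x1, z, z1]).trans h1)
          refine ⟨x, y, z1, sub_eraseE
            ((by simp : [x, y, z1].Sublist ([x, y] ++ [z, z1])).trans g) ?_,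
            hxy, by omega, rfl⟩
          simp; omega
        · refine ⟨x, y, z, sub_eraseE h ?_, hxy, hyz, rfl⟩
          simp; omega
    · simp only [selE, if_true] at hv ⊢
      by_cases hx : x = z1
      · subst hx
        have g := glueE hl (u := [x1, y1]) (a := x) (v := [y, z]) h1 h
        refine ⟨x1, y1, z, sub_eraseE
          ((by simp : [x1, y1, z].Sublist ([x1, y1] ++ [x, y, z])).trans g) ?_,
          hxy1, by omega, rfl⟩
        simp; omega
      · by_cases hy : y = z1
        · subst hy
          have g := glueE hl (u := [x1, y1]) (a := y) (v := [z]) h1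
            ((by simp : ([y, z]).Sublist [x, y, z]).trans h)
          refine ⟨x1, y1, z, sub_eraseE
            ((by simp : [x1, y1, z].Sublist ([x1, y1] ++ [y, z])).trans g) ?_,
            hxy1, by omega, rfl⟩
          simp; omega
        · refine ⟨x, y, z, sub_eraseE h ?_, hxy, hyz, rfl⟩
          simp; omega

lemma nf_eraseE (c : Bool) {l : List ℕ} (hl : l.Nodup) {w : ℕ} (hw : BadE c l w) :
    nfE c (l.erase w) = nfE c l := by
  classical
  unfold nfE
  conv_lhs => arg 2; rw [hl.erase_eq_filter]
  rw [List.filter_filter]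
  apply List.filter_congr
  intro v _
  by_cases hv : v = w
  · subst hv; simp [hw]
  · simp [hv, bad_eraseE c hl hw hv]

/-- strictly monotone on the entries -/
def MonoE (f : ℕ → ℕ) (l : List ℕ) : Prop := ∀ x ∈ l, ∀ y ∈ l, (x < y ↔ f x < f y)

lemma MonoE.inj {f : ℕ → ℕ} {l : List ℕ} (h : MonoE f l) {x y : ℕ} (hx : x ∈ l) (hy : y ∈ l)
    (e : f x = f y) : x = y := by
  have h1 := h x hx y hy
  have h2 := h y hy x hx
  omega

lemma MonoE.sub {f : ℕ → ℕ} {l m : List ℕ} (h : MonoE f l) (hm : m ⊆ l) : MonoE f m :=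
  fun x hx y hy => h x (hm hx) y (hm hy)

lemma bad_mapE (c : Bool) {l : List ℕ} {f : ℕ → ℕ} (hf : MonoE f l) {w : ℕ} (hw : w ∈ l) :
    BadE c (l.map f) (f w) ↔ BadE c l w := by
  constructor
  · rintro ⟨x, y, z, h, hxy, hyz, e⟩
    obtain ⟨t, ht, e'⟩ := List.sublist_map_iff.1 h
    match t, e' with
    | [x', y', z'], e' =>
      simp only [List.map_cons, List.map_nil, List.cons.injEq, and_true] at e'
      obtain ⟨rfl, rfl, rfl⟩ := e'
      have mx : x' ∈ l := ht.subset (by simp)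
      have my : y' ∈ l := ht.subset (by simp)
      have mz : z' ∈ l := ht.subset (by simp)
      refine ⟨x', y', z', ht, (hf _ mx _ my).2 hxy, (hf _ my _ mz).2 hyz, ?_⟩
      cases c <;> simp [selE] at e ⊢ <;> exact hf.inj hw (by assumption) e
  · rintro ⟨x, y, z, h, hxy, hyz, e⟩
    have mx : x ∈ l := h.subset (by simp)
    have my : y ∈ l := h.subset (by simp)
    have mz : z ∈ l := h.subset (by simp)
    refine ⟨f x, f y, f z, h.map f, (hf _ mx _ my).1 hxy, (hf _ my _ mz).1 hyz, ?_⟩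
    cases c <;> simp [selE] at e ⊢ <;> rw [e]

lemma nf_mapE (c : Bool) {l : List ℕ} {f : ℕ → ℕ} (hf : MonoE f l) :
    nfE c (l.map f) = (nfE c l).map f := by
  classical
  unfold nfE
  rw [List.filter_map]
  congr 1
  apply List.filter_congr
  intro v hv
  simp [bad_mapE c hf hv]

lemma renumber_mapE {l : List ℕ} {f : ℕ → ℕ} (hf : MonoE f l) :
    renumber (l.map f) = renumber l := by
  unfold renumber
  rw [List.map_map]
  apply List.map_congr_left
  intro x hx
  simp only [Function.comp]
  rw [List.filter_map, List.length_map]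
  congr 1
  apply List.filter_congr
  intro y hy
  have := hf x hx y hy
  simp only [Function.comp, decide_eq_decide]
  omega

lemma OrdIso.symmE {u v : List ℕ} (h : OrdIso u v) : OrdIso v u :=
  ⟨h.1.symm, fun i j hi hj => (h.2 i j (h.1 ▸ hi) (h.1 ▸ hj)).symm⟩

lemma OrdIso.reflE (u : List ℕ) : OrdIso u u := ⟨rfl, fun _ _ _ _ => Iff.rfl⟩

lemma ordIso_mapE {l : List ℕ} {f : ℕ → ℕ} (hf : MonoE f l) : OrdIso l (l.map f) := by
  refine ⟨by simp, fun i j hi hj => ?_⟩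
  have := hf l[i] (by simp) l[j] (by simp)
  simpa [hi, hj, List.getD_eq_getElem?_getD] using this

lemma OrdIso.exE {l m : List ℕ} (h : OrdIso l m) (hl : l.Nodup) :
    ∃ f, MonoE f l ∧ m = l.map f := by
  refine ⟨fun x => m.getD (l.idxOf x) 0, ?_, ?_⟩
  · intro x hx y hy
    have hx' := List.idxOf_lt_length_of_mem hx
    have hy' := List.idxOf_lt_length_of_mem hy
    have := h.2 _ _ hx' hy'
    simpa [List.getD_eq_getElem?_getD, hx', hy'] using this
  · apply List.ext_getElem
    · simp [h.1]
    · intro i h1 h2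
      simp only [List.length_map] at h2
      simp [hl.idxOf_getElem, h1]

lemma MonoE.nodup {f : ℕ → ℕ} {l : List ℕ} (h : MonoE f l) (hl : l.Nodup) : (l.map f).Nodup :=
  List.Nodup.map_on (fun _ hx _ hy e => h.inj hx hy e) hl

lemma OrdIso.nodupE {l m : List ℕ} (h : OrdIso l m) (hl : l.Nodup) : m.Nodup := by
  obtain ⟨f, hf, rfl⟩ := h.exE hl
  exact hf.nodup hl

/-- renumbered normal form -/
noncomputable def qE (c : Bool) (l : List ℕ) : List ℕ := renumber (nfE c l)

lemma q_ordIsoE (c : Bool) {l m : List ℕ} (h : OrdIso l m) (hl : l.Nodup) : qE c l = qE c m := by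
  obtain ⟨f, hf, rfl⟩ := h.exE hl
  unfold qE
  rw [nf_mapE c hf, renumber_mapE (hf.sub _)]
  exact List.filter_sublist.subset

lemma rank_monoE (l : List ℕ) : MonoE (fun x => (l.filter fun y => y ≤ x).length) l := by
  have key : ∀ x y, x ≤ y → (l.filter fun t => t ≤ x).length ≤ (l.filter fun t => t ≤ y).length := by
    intro x y h
    rw [← List.countP_eq_length_filter, ← List.countP_eq_length_filter]
    apply List.countP_mono_left
    intro t _ ht
    simp at ht ⊢; omega
  intro x hx y hy
  constructor
  · intro h
    have hs : ((l.filter fun t => t ≤ x)) = (l.filter fun t => t ≤ y).filter (fun t => t ≤ x) := by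
      rw [List.filter_filter]
      apply List.filter_congr
      intro t _
      rw [Bool.eq_iff_iff]; simp; omega
    show (l.filter fun t => t ≤ x).length < (l.filter fun t => t ≤ y).length
    rw [hs, List.length_filter_lt_length_iff_exists]
    exact ⟨y, by simp [hy], by simpa using h⟩
  · intro h
    by_contra hc
    have := key y x (by omega)
    simp only at h
    omega

lemma renumber_ordIsoE (l : List ℕ) : OrdIso l (renumber l) := ordIso_mapE (rank_monoE l)

lemma renumber_permE {l : List ℕ} (hl : l.Nodup) : IsPermList (renumber l) := by
  have hn : (renumber l).Nodup := (rank_monoE l).nodup hl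
  unfold IsPermList
  apply List.Subperm.perm_of_length_le
  · apply List.subperm_of_subset hn
    intro a ha
    have hlen : (renumber l).length = l.length := by simp [renumber]
    rw [hlen]
    simp only [renumber, List.mem_map] at ha
    obtain ⟨x, hx, rfl⟩ := ha
    rw [List.mem_range'_1]
    have h1 : 0 < (l.filter fun y => y ≤ x).length :=
      List.length_pos_of_mem (a := x) (by simp [hx])
    have h2 := List.length_filter_le (fun y => decide (y ≤ x)) l
    omega
  · simp

lemma IsPermList.nodupE {l : List ℕ} (h : IsPermList l) : l.Nodup :=
  (List.Perm.nodup_iff h).2 List.nodup_range'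

lemma IsPermList.posE {l : List ℕ} (h : IsPermList l) : ∀ k ∈ l, 0 < k := by
  intro k hk
  have := h.subset hk
  rw [List.mem_range'_1] at this
  omega

lemma range_rankE (n x : ℕ) : ((List.range' 1 n).filter fun y => y ≤ x).length = min x n := by
  induction n with
  | zero => simp
  | succ n ih =>
    rw [List.range'_concat, List.filter_append, List.length_append, ih]
    by_cases h : 1 + n ≤ x
    · simp only [List.filter_cons, List.filter_nil, Nat.one_mul, h, decide_true, if_true,
        List.length_singleton]
      omega
    · simp only [List.filter_cons, List.filter_nil, Nat.one_mul, h, decide_false,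
        Bool.false_eq_true, if_false, List.length_nil]
      omega

lemma renumber_selfE {l : List ℕ} (h : IsPermList l) : renumber l = l := by
  unfold renumber
  conv_rhs => rw [← List.map_id l]
  apply List.map_congr_left
  intro x hx
  have h1 := (List.Perm.filter (fun y => decide (y ≤ x)) h).length_eq
  rw [h1, range_rankE]
  have := h.subset hx
  rw [List.mem_range'_1] at this
  simp; omega

/-! ### the iteration -/

lemma mem_triplesE {l : List ℕ} {i j k : ℕ} : (i, j, k) ∈ triples123 l ↔
    i < j ∧ j < k ∧ k < l.length ∧ l.getD i 0 < l.getD j 0 ∧ l.getD j 0 < l.getD k 0 := by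
  unfold triples123
  simp only [List.mem_flatMap, List.mem_range, List.mem_filterMap]
  constructor
  · rintro ⟨i', hi, j', hj, k', hk, h⟩
    split_ifs at h with hc
    simp only [Option.some.injEq, Prod.mk.injEq] at h
    obtain ⟨rfl, rfl, rfl⟩ := h
    exact ⟨hc.1, hc.2.1, hk, hc.2.2⟩
  · rintro ⟨h1, h2, h3, h4⟩
    exact ⟨i, by omega, j, by omega, k, h3, by rw [if_pos ⟨h1, h2, h4⟩]⟩

lemma pair_subE (l : List ℕ) {i j : ℕ} (hij : i < j) (hj : j < l.length) :
    [l[i], l[j]].Sublist l := by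
  have h : l.Pairwise (fun a b => [a, b].Sublist l) :=
    List.pairwise_iff_forall_sublist.2 (fun h => h)
  exact List.pairwise_iff_getElem.1 h i j _ hj hij

/-- Position selector. -/
def posE (c : Bool) (t : ℕ × ℕ × ℕ) : ℕ := if c then t.2.2 else t.2.1

lemma triple_badE (c : Bool) {l : List ℕ} (hl : l.Nodup) {t : ℕ × ℕ × ℕ}
    (h : t ∈ triples123 l) : ∃ w, BadE c l w ∧ l.eraseIdx (posE c t) = l.erase w := by
  obtain ⟨i, j, k⟩ := t
  obtain ⟨h1, h2, h3, h4, h5⟩ := mem_triplesE.1 h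
  have hj : j < l.length := by omega
  have hi : i < l.length := by omega
  simp only [List.getD_eq_getElem?_getD, hi, hj, h3, List.getElem?_eq_getElem, Option.getD_some] at h4 h5
  have g := glueE hl (u := [l[i]]) (a := l[j]) (v := [l[k]]) (pair_subE l h1 hj) (pair_subE l h2 h3)
  refine ⟨selE c l[j] l[k], ⟨l[i], l[j], l[k], g, h4, h5, rfl⟩, ?_⟩
  cases c
  · simp [posE, selE, hl.erase_getElem]
  · simp [posE, selE, hl.erase_getElem]

lemma bad_tripleE {c : Bool} {l : List ℕ} {w : ℕ} (h : BadE c l w) : triples123 l ≠ [] := by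
  obtain ⟨x, y, z, hs, hxy, hyz, -⟩ := h
  obtain ⟨f, hf⟩ := List.sublist_iff_exists_fin_orderEmbedding_get_eq.1 hs
  have e0 := hf ⟨0, by simp⟩
  have e1 := hf ⟨1, by simp⟩
  have e2 := hf ⟨2, by simp⟩
  have l1 : f ⟨0, by simp⟩ < f ⟨1, by simp⟩ := f.lt_iff_lt.2 (by simp)
  have l2 : f ⟨1, by simp⟩ < f ⟨2, by simp⟩ := f.lt_iff_lt.2 (by simp)
  simp at e0 e1 e2
  apply List.ne_nil_of_mem (a := ((f ⟨0, by simp⟩).1, (f ⟨1, by simp⟩).1, (f ⟨2, by simp⟩).1))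
  rw [mem_triplesE]
  refine ⟨l1, l2, (f _).2, ?_, ?_⟩
  · simp only [List.getD_eq_getElem?_getD, Fin.is_lt, List.getElem?_eq_getElem, Option.getD_some]
    simp [← e0, ← e1, hxy]
  · simp only [List.getD_eq_getElem?_getD, Fin.is_lt, List.getElem?_eq_getElem, Option.getD_some]
    simp [← e1, ← e2, hyz]

/-- Erasing along bad entries. -/
inductive ReachE (c : Bool) : List ℕ → List ℕ → Prop
  | refl (l) : ReachE c l l
  | step {l w m} : BadE c l w → ReachE c (l.erase w) m → ReachE c l m

lemma pIter_specE (c : Bool) (n : ℕ) : ∀ l : List ℕ, l.Nodup → l.length ≤ n →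
    ReachE c l (nfE c l) ∧ pIter (posE c) n l = nfE c l := by
  classical
  have hdone : ∀ l : List ℕ, triples123 l = [] → nfE c l = l := by
    intro l h
    unfold nfE
    rw [List.filter_eq_self]
    intro a _
    simp only [decide_eq_true_eq]
    exact fun hb => bad_tripleE hb h
  induction n with
  | zero =>
    intro l _ h
    have : l = [] := List.length_eq_zero_iff.1 (by omega)
    subst this
    exact ⟨ReachE.refl _, rfl⟩
  | succ n ih =>
    intro l hl h
    unfold pIter
    cases ht : leftmost123 l with
    | none =>
      have h0 := hdone l (by simpa [leftmost123] using ht)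
      rw [h0]
      exact ⟨ReachE.refl _, rfl⟩
    | some t =>
      have hm : t ∈ triples123 l := List.mem_of_head? ht
      obtain ⟨w, hw, he⟩ := triple_badE c hl hm
      have hwl : w ∈ l := by
        obtain ⟨x, y, z, hs, -, -, e⟩ := hw
        apply hs.subset
        cases c <;> simp [selE, e]
      have hlen := List.length_erase_of_mem hwl
      have hpos := List.length_pos_of_mem hwl
      obtain ⟨i1, i2⟩ := ih (l.erase w) (hl.erase w) (by omega)
      rw [nf_eraseE c hl hw] at i1 i2
      refine ⟨ReachE.step hw i1, ?_⟩
      simp only [he]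
      exact i2

/-! ### replacements -/

/-- the pattern -/
def patE (c : Bool) : SPat := if c then pat12S else pat1S3

/-- The list of options after deletion. -/
def delE (c : Bool) (x y z : ℕ) : SPat :=
  if c then [some x, some y, none] else [some x, none, some z]

lemma Repl.symmE {a b r s : SPat} (h : Repl a b r s) : Repl b a s r := by
  induction h with
  | nil => exact .nil
  | keep x _ ih => exact .keep x ih
  | repl x y _ ih => exact .repl y x ih

lemma Repl.subE {a b r s : SPat} (h : Repl a b r s) : a.Sublist r := by
  induction h with
  | nil => simp
  | keep x _ ih => exact ih.cons x
  | repl x y _ ih => exact ih.cons_cons x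

lemma Repl.exE {a r : SPat} (h : a.Sublist r) :
    ∀ b : SPat, b.length = a.length → ∃ s, Repl a b r s := by
  induction h with
  | slnil => intro b hb; have : b = [] := by simpa using hb
             subst this; exact ⟨[], .nil⟩
  | cons x _ ih =>
    intro b hb
    obtain ⟨s, hs⟩ := ih b hb
    exact ⟨_, .keep x hs⟩
  | cons_cons x _ ih =>
    intro b hb
    match b, hb with
    | y :: b, hb =>
      obtain ⟨s, hs⟩ := ih b (by simpa using hb)
      exact ⟨_, .repl x y hs⟩

lemma ints_consE (x : Option ℕ) (r : SPat) : ints (x :: r) = x.toList ++ ints r := by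
  cases x <;> simp [ints]

lemma Repl.permE {a b r s : SPat} (h : Repl a b r s) :
    (ints r ++ ints b).Perm (ints s ++ ints a) := by
  induction h with
  | nil => simp
  | keep x _ ih =>
    rw [ints_consE, ints_consE, List.append_assoc, List.append_assoc]
    exact ih.append_left _
  | repl x y _ ih =>
    simp only [ints_consE]
    rw [← Multiset.coe_eq_coe] at ih ⊢
    simp only [← Multiset.coe_add] at ih ⊢
    rw [show ∀ p q r s : Multiset ℕ, p + q + (r + s) = (p + r) + (q + s) by intros; abel, ih]
    abel

lemma Repl.filterE {a b r s : SPat} (w : ℕ) (h : Repl a b r s) :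
    List.Forall₂ (fun p q => q = p ∨ (p = some w ∧ q = none)) a b →
    (ints r).filter (fun v => v ≠ w) = (ints s).filter (fun v => v ≠ w) := by
  induction h with
  | nil => simp
  | keep x _ ih =>
    intro hf
    rw [ints_consE, ints_consE, List.filter_append, List.filter_append, ih hf]
  | repl x y _ ih =>
    intro hf
    rw [List.forall₂_cons] at hf
    rw [ints_consE, ints_consE, List.filter_append, List.filter_append, ih hf.2]
    rcases hf.1 with rfl | ⟨rfl, rfl⟩
    · rfl
    · simp

lemma repl_mainE (c : Bool) {x y z : ℕ} {r s : SPat}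
    (h : Repl [some x, some y, some z] (delE c x y z) r s) :
    (ints r).Perm (selE c y z :: ints s) ∧
    ((ints r).Nodup → ints s = (ints r).erase (selE c y z)) ∧
    [x, y, z].Sublist (ints r) := by
  have hp : (ints r).Perm (selE c y z :: ints s) := by
    have hperm := h.permE
    rw [List.perm_iff_count]
    intro t
    have e := hperm.count_eq t
    cases c <;> simp only [delE, Bool.false_eq_true, if_false, if_true, selE, ints_consE,
      Option.toList, List.count_append, List.count_cons, List.count_nil, show ints [] = [] from rfl]
      at e ⊢ <;> omega
  refine ⟨hp, ?_, ?_⟩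
  · intro hn
    have hn' := hp.nodup_iff.1 hn
    rw [List.nodup_cons] at hn'
    have hf := h.filterE (selE c y z) (by cases c <;> simp [delE, selE])
    rw [hn.erase_eq_filter]
    have e2 : (ints s).filter (fun v => v ≠ selE c y z) = ints s := by
      rw [List.filter_eq_self]
      intro a ha
      simp only [decide_eq_true_eq]
      rintro rfl
      exact hn'.1 ha
    rw [e2] at hf
    rw [← hf]
    apply List.filter_congr
    intro v _
    by_cases hv : v = selE c y z <;> simp [hv]
  · have := h.subE.filterMap id
    simpa [ints] using this

lemma copy123E {a : SPat} (h : IsCopy a pat123) :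
    ∃ x y z, a = [some x, some y, some z] ∧ x < y ∧ y < z := by
  obtain ⟨h1, h2, h3⟩ := h
  match a, h1 with
  | [p, q, r], _ =>
    have e0 := h2 0
    have e1 := h2 1
    have e2 := h2 2
    simp [pat123] at e0 e1 e2
    obtain ⟨x, rfl⟩ := Option.ne_none_iff_exists'.1 e0
    obtain ⟨y, rfl⟩ := Option.ne_none_iff_exists'.1 e1
    obtain ⟨z, rfl⟩ := Option.ne_none_iff_exists'.1 e2
    have f0 := h3.2 0 1 (by simp [ints]) (by simp [ints])
    have f1 := h3.2 1 2 (by simp [ints]) (by simp [ints])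
    simp [ints, pat123] at f0 f1
    exact ⟨x, y, z, rfl, f0, f1⟩

lemma isCopy123E {x y z : ℕ} (h1 : x < y) (h2 : y < z) :
    IsCopy [some x, some y, some z] pat123 := by
  refine ⟨rfl, ?_, rfl, ?_⟩
  · intro i
    rcases i with _ | _ | _ | i <;> simp [pat123]
  · intro i j hi hj
    simp only [ints, List.filterMap, id, List.length] at hi hj
    interval_cases i <;> interval_cases j <;> simp [ints, pat123] <;> omega

lemma isCopyDelE (c : Bool) {x y z : ℕ} (h1 : x < y) (h2 : y < z) :
    IsCopy (delE c x y z) (patE c) := by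
  cases c
  · refine ⟨rfl, ?_, rfl, ?_⟩
    · intro i
      rcases i with _ | _ | _ | i <;> simp [patE, delE, pat1S3]
    · intro i j hi hj
      simp [ints, delE] at hi hj
      interval_cases i <;> interval_cases j <;> simp [ints, patE, delE, pat1S3] <;> omega
  · refine ⟨rfl, ?_, rfl, ?_⟩
    · intro i
      rcases i with _ | _ | _ | i <;> simp [patE, delE, pat12S]
    · intro i j hi hj
      simp [ints, delE] at hi hj
      interval_cases i <;> interval_cases j <;> simp [ints, patE, delE, pat12S] <;> omega

lemma common1E (c : Bool) (x y z i j k : ℕ) (h1 : pat123.getD i none = some k)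
    (h2 : (patE c).getD j none = some k) :
    List.getD [some x, some y, some z] i none = (delE c x y z).getD j none := by
  cases c <;> rcases i with _ | _ | _ | i <;> rcases j with _ | _ | _ | j <;>
    simp [pat123, patE, pat12S, pat1S3, delE] at h1 h2 ⊢ <;> omega

lemma copyDelE (c : Bool) {b : SPat} {x y z : ℕ} (hb : IsCopy b (patE c))
    (h : ∀ i j k, pat123.getD i none = some k → (patE c).getD j none = some k →
      List.getD [some x, some y, some z] i none = b.getD j none) : b = delE c x y z := by
  obtain ⟨h1, h2, -⟩ := hb
  have h1' : b.length = 3 := by cases c <;> simpa [patE, pat12S, pat1S3] using h1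
  match b, h1' with
  | [p, q, r], _ =>
    cases c
    · have e0 := h 0 0 1 (by simp [pat123]) (by simp [patE, pat1S3])
      have e1 := (h2 1).2 (by simp [patE, pat1S3])
      have e2 := h 2 2 3 (by simp [pat123]) (by simp [patE, pat1S3])
      simp at e0 e1 e2
      simp [delE, ← e0, e1, ← e2]
    · have e0 := h 0 0 1 (by simp [pat123]) (by simp [patE, pat12S])
      have e1 := h 1 1 2 (by simp [pat123]) (by simp [patE, pat12S])
      have e2 := (h2 2).2 (by simp [patE, pat12S])
      simp at e0 e1 e2
      simp [delE, ← e0, ← e1, e2]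

lemma forwardE (c : Bool) {π σ : List ℕ} (hπ : π.Nodup) (h : IsResult pat123 (patE c) π σ) :
    σ.Nodup ∧ qE c π = qE c σ := by
  obtain ⟨r, s, a, b, hr, hπr, ha, hb, hbc, -, hcom, hrep, hσ, hsσ⟩ := h
  obtain ⟨x, y, z, rfl, hxy, hyz⟩ := copy123E ha
  obtain rfl := copyDelE c hbc hcom
  obtain ⟨-, he, hsub⟩ := repl_mainE c hrep
  have he := he hr.1
  refine ⟨hσ.nodupE, ?_⟩
  rw [q_ordIsoE c hπr hπ, ← q_ordIsoE c hsσ (he ▸ hr.1.erase _), he]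
  unfold qE
  rw [nf_eraseE c hr.1 ⟨x, y, z, hsub, hxy, hyz, rfl⟩]

lemma backwardE (c : Bool) {π σ : List ℕ} (hπ : π.Nodup) (h : IsResult (patE c) pat123 π σ) :
    σ.Nodup ∧ qE c π = qE c σ := by
  obtain ⟨r, s, a, b, hr, hπr, ha, hb, hbc, hnew, hcom, hrep, hσ, hsσ⟩ := h
  obtain ⟨x, y, z, rfl, hxy, hyz⟩ := copy123E hbc
  obtain rfl := copyDelE c (b := a) (x := x) (y := y) (z := z) ha
    (fun i j k h1 h2 => (hcom j i k h2 h1).symm)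
  obtain ⟨hp, he, hsub⟩ := repl_mainE c hrep.symmE
  have hs : (ints s).Nodup := by
    rw [hp.nodup_iff, List.nodup_cons]
    refine ⟨fun hm => ?_, hr.1⟩
    have := hnew _ (by cases c <;> simp [ints, selE]) hm
    cases c <;> simp [ints, selE, delE] at this <;> omega
  have he := he hs
  refine ⟨hσ.nodupE, ?_⟩
  rw [q_ordIsoE c hπr hπ, ← q_ordIsoE c hsσ hs, he]
  unfold qE
  rw [nf_eraseE c hs ⟨x, y, z, hsub, hxy, hyz, rfl⟩]

lemma stepE (c : Bool) {l : List ℕ} (hl : l.Nodup) (hpos : ∀ k ∈ l, 0 < k) {w : ℕ}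
    (hw : BadE c l w) :
    IsResult pat123 (patE c) (renumber l) (renumber (l.erase w)) ∧
    IsResult (patE c) pat123 (renumber (l.erase w)) (renumber l) := by
  obtain ⟨x, y, z, hs, hxy, hyz, rfl⟩ := hw
  have hsub : [some x, some y, some z].Sublist (l.map some) := by simpa using hs.map some
  obtain ⟨s, hrep⟩ := Repl.exE hsub (delE c x y z) (by cases c <;> rfl)
  have hi : ints (l.map some) = l := by simp [ints]
  obtain ⟨hp, he, -⟩ := repl_mainE c hrep
  rw [hi] at hp he
  have he := he hl
  have hx : 0 < x := hpos x (hs.subset (by simp))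
  have hn := hp.nodup_iff.1 hl
  rw [List.nodup_cons] at hn
  have hmem : ∀ k ∈ ints (delE c x y z), k ∈ [x, y, z] := by
    intro k; cases c <;> simp [ints, delE] <;> tauto
  refine ⟨⟨l.map some, s, _, _, ?_, ?_, isCopy123E hxy hyz, ?_, isCopyDelE c hxy hyz, ?_,
    common1E c x y z, hrep, renumber_permE (hl.erase _), ?_⟩,
    ⟨s, l.map some, _, _, ?_, ?_, isCopyDelE c hxy hyz, ?_, isCopy123E hxy hyz, ?_,
    fun i j k h1 h2 => (common1E c x y z j i k h2 h1).symm, hrep.symmE, renumber_permE hl, ?_⟩⟩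
  · rw [StarStr, hi]; exact ⟨hl, hpos⟩
  · rw [hi]; exact (renumber_ordIsoE l).symmE
  · constructor
    · cases c <;> simp [ints, delE] <;> omega
    · intro k hk
      exact hpos k (hs.subset (hmem k hk))
  · intro k hk _
    simpa [ints] using hmem k hk
  · rw [he]; exact renumber_ordIsoE _
  · exact ⟨hn.2, fun k hk => hpos k (List.mem_of_mem_erase (he ▸ hk))⟩
  · rw [he]; exact (renumber_ordIsoE _).symmE
  · constructor
    · simp [ints]; omega
    · simp [ints]; omega
  · intro k hk hks
    have hne : k ≠ selE c y z := fun e => hn.1 (e ▸ hks)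
    cases c <;> simp [ints, delE, selE] at hk hne ⊢ <;> omega
  · rw [hi]; exact renumber_ordIsoE l

lemma reach_equivE (c : Bool) {l m : List ℕ} (h : ReachE c l m) :
    l.Nodup → (∀ k ∈ l, 0 < k) →
    PermEquiv pat123 (patE c) (renumber l) (renumber m) ∧
    PermEquiv pat123 (patE c) (renumber m) (renumber l) := by
  induction h with
  | refl l => intro _ _; exact ⟨.refl, .refl⟩
  | step hw _ ih =>
    intro hl hpos
    obtain ⟨s1, s2⟩ := stepE c hl hpos hw
    obtain ⟨i1, i2⟩ := ih (hl.erase _) (fun k hk => hpos k (List.mem_of_mem_erase hk))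
    exact ⟨.head (Or.inl s1) i1, .tail i2 (Or.inr s2)⟩

lemma mainE (c : Bool) (π σ : List ℕ) (hπ : IsPermList π) (hσ : IsPermList σ) :
    PermEquiv pat123 (patE c) π σ ↔ pGamma (posE c) π = pGamma (posE c) σ := by
  have key : ∀ l : List ℕ, l.Nodup → pGamma (posE c) l = qE c l := by
    intro l hl
    unfold pGamma qE
    rw [(pIter_specE c _ l hl le_rfl).2]
  rw [key π hπ.nodupE, key σ hσ.nodupE]
  constructor
  · intro h
    have : σ.Nodup ∧ qE c π = qE c σ := by
      clear hσ
      induction h with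
      | refl => exact ⟨hπ.nodupE, rfl⟩
      | tail _ h ih =>
        rcases h with h | h
        · have := forwardE c ih.1 h
          exact ⟨this.1, ih.2.trans this.2⟩
        · have := backwardE c ih.1 h
          exact ⟨this.1, ih.2.trans this.2⟩
    exact this.2
  · intro h
    have h1 := (reach_equivE c (pIter_specE c _ π hπ.nodupE le_rfl).1 hπ.nodupE hπ.posE).1
    have h2 := (reach_equivE c (pIter_specE c _ σ hσ.nodupE le_rfl).1 hσ.nodupE hσ.posE).2
    rw [renumber_selfE hπ] at h1
    rw [renumber_selfE hσ] at h2
    unfold qE at h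
    rw [h] at h1
    exact Relation.ReflTransGen.trans h1 h2

/-- for `γ ∈ {12★, 1★3}`, two permutations are equivalent under
`123 ↔ γ` if and only if they have the same `p_γ`. -/
theorem pGamma_equivalenceCondition :
    (∀ π σ : List ℕ, IsPermList π → IsPermList σ →
      (PermEquiv pat123 pat12S π σ ↔ p12star π = p12star σ)) ∧
    (∀ π σ : List ℕ, IsPermList π → IsPermList σ →
      (PermEquiv pat123 pat1S3 π σ ↔ p1star3 π = p1star3 σ)) := by
  exact ⟨mainE true, mainE false⟩
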